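/- Let p be a prime, m a natural number, k ≥ 1 a natural number, and 1 ≤ l ≤ p^{m+1}. Then the binomial coefficient C(p^{m+1}·k + l, l) is congruent to C(p·k + ⌊l/p^m⌋, ⌊l/p^m⌋) modulo p. -/

import Mathlib

theorem stmt_4_aux (p k : ℕ) (hp : p.Prime) (m : ℕ) : ∀ l : ℕ,
    Nat.choose (p ^ (m + 1) * k + l) l ≡
      Nat.choose (p * k + l / p ^ m) (l / p ^ m) [MOD p] := by
  haveI : Fact p.Prime := ⟨hp⟩
  induction m with
  | zero => intro l; simp [Nat.ModEq]
  | succ m ih =>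
    intro l
    have h := Choose.choose_modEq_choose_mod_mul_choose_div_nat
      (n := p ^ (m + 1 + 1) * k + l) (k := l) (p := p)
    have e : p ^ (m + 1 + 1) * k + l = l + p * (p ^ (m + 1) * k) := by ring
    have e1 : (p ^ (m + 1 + 1) * k + l) % p = l % p := by
      rw [e, Nat.add_mul_mod_self_left]
    have e2 : (p ^ (m + 1 + 1) * k + l) / p = p ^ (m + 1) * k + l / p := by
      rw [e, Nat.add_mul_div_left _ _ hp.pos, add_comm]
    rw [e1, e2, Nat.choose_self, one_mul] at h
    have h2 := ih (l / p)
    rw [Nat.div_div_eq_div_mul, ← pow_succ'] at h2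
    exact h.trans h2

/-- For a prime `p`, `m : ℕ`, `k ≥ 1` and `1 ≤ l ≤ p^{m+1}`, the binomial
coefficient `C(p^{m+1}·k + l, l)` is congruent to
`C(p·k + ⌊l/p^m⌋, ⌊l/p^m⌋)` modulo `p`. -/
theorem stmt_4 (p m k l : ℕ) (hp : p.Prime) (hk : 1 ≤ k)
    (hl1 : 1 ≤ l) (hl2 : l ≤ p ^ (m + 1)) :
    Nat.choose (p ^ (m + 1) * k + l) l ≡
      Nat.choose (p * k + l / p ^ m) (l / p ^ m) [MOD p] :=
  stmt_4_aux p k hp m l
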